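/- arXiv:2311.16959 — 7 statements merged into one kernel-verified Lean document; each statement's English description precedes it below -/
import Mathlib

section
/- Let a* ∈ {1,…,n} and s* ∈ ℝ satisfy s* > 0, s* ≥ c_{a*}, and r_{a*} − s* ≥ max{0, r_â − c_â}. Define the binary-signal information structure by π_i = 1 if i = a* or c_i > c_{a*}, and π_i = p* := 1 − (c_{a*} − c_â)/s* for all other i ∈ {1,…,n}. Then: (i) under the contract (t₁, t₂) = (s*, 0), the action a* maximizes the agent's utility T_i − c_i over all actions i ∈ {0,1,…,n}, the agent's utility at a* equals s* − c_{a*}, and the principal's utility at a* equals r_{a*} − s*; (ii) for every contract (t₁, t₂) with t₁, t₂ ≥ 0 and every action i ∈ {0,1,…,n} that maximizes the agent's utility T_i − c_i under that contract, the principal's utility r_i − T_i is at most r_{a*} − s*. Hence this information structure induces the equilibrium utility profile (r_{a*} − s*, s* − c_{a*}). -/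
/-- Induced equilibrium with a risk-neutral agent.  Actions are `0, 1, …, n`
with rewards `r` and costs `c` (`r 0 = c 0 = 0`); `ahat` is the cost-effective
action; `a` is the target action and `s` the target transfer with `s > 0`,
`s ≥ c a` and `r a - s ≥ max 0 (r ahat - c ahat)`.  The binary-signal
information structure `π` sends the first signal with probability `1` at `a`
and at every costlier action, and with probability `p* = 1 - (c a - c ahat)/s`
otherwise; `T t₁ t₂ i` is the expected transfer at action `i` under the
contract `(t₁, t₂)`.  Then (i) under the contract `(s, 0)` the action `a`
maximizes the agent's utility `T i - c i`, the agent's utility at `a` is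
`s - c a`, and the principal's utility at `a` is `r a - s`; and (ii) for every
nonnegative contract and every agent-optimal action `i`, the principal's
utility `r i - T i` is at most `r a - s`. -/
theorem stmt_0
    (n : ℕ) (r c : ℕ → ℝ)
    (hr_nonneg : ∀ i ≤ n, 0 ≤ r i) (hc_nonneg : ∀ i ≤ n, 0 ≤ c i)
    (hr0 : r 0 = 0) (hc0 : c 0 = 0)
    (ahat : ℕ) (hahat1 : 1 ≤ ahat) (hahatn : ahat ≤ n)
    (hahat_cost : ∀ i, 1 ≤ i → i ≤ n → c ahat ≤ c i)
    (hahat_rew : ∀ i, 1 ≤ i → i ≤ n → c i = c ahat → r i ≤ r ahat)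
    (a : ℕ) (ha1 : 1 ≤ a) (han : a ≤ n)
    (s : ℝ) (hs_pos : 0 < s) (hs_cost : c a ≤ s)
    (hs_impl : max 0 (r ahat - c ahat) ≤ r a - s)
    (π : ℕ → ℝ)
    (hπ : ∀ i, π i = if i = a ∨ c a < c i then 1 else 1 - (c a - c ahat) / s)
    (T : ℝ → ℝ → ℕ → ℝ)
    (hT : ∀ t₁ t₂ i, T t₁ t₂ i = if i = 0 then 0 else π i * t₁ + (1 - π i) * t₂) :
    -- (i) the contract (s, 0) induces the action a with utility profile
    --     (r a - s, s - c a)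
    ((∀ i ≤ n, T s 0 i - c i ≤ T s 0 a - c a) ∧
      T s 0 a - c a = s - c a ∧
      r a - T s 0 a = r a - s) ∧
    -- (ii) no contract gives the principal more than r a - s at an
    --      agent-optimal action
    (∀ t₁ t₂ : ℝ, 0 ≤ t₁ → 0 ≤ t₂ →
      ∀ i ≤ n, (∀ j ≤ n, T t₁ t₂ j - c j ≤ T t₁ t₂ i - c i) →
        r i - T t₁ t₂ i ≤ r a - s) := by
  have hahat0 : ahat ≠ 0 := by omega
  have ha0 : a ≠ 0 := by omega
  have h_default : 0 ≤ r a - s := (le_max_left _ _).trans hs_impl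
  have h_ahat : r ahat - c ahat ≤ r a - s := (le_max_right _ _).trans hs_impl
  have hq : (c a - c ahat) / s * s = c a - c ahat := div_mul_cancel₀ _ hs_pos.ne'
  have hca : c ahat ≤ c a := hahat_cost a ha1 han
  have hπa : π a = 1 := by simp [hπ]
  have hT0 : ∀ t₁ t₂, T t₁ t₂ 0 = 0 := fun t₁ t₂ => by simp [hT]
  have hTi : ∀ t₁ t₂ i, i ≠ 0 → T t₁ t₂ i = π i * t₁ + (1 - π i) * t₂ :=
    fun t₁ t₂ i hi => by simp [hT, hi]
  have hTa : ∀ t₁ t₂, T t₁ t₂ a = t₁ := fun t₁ t₂ => by simp [hTi _ _ a ha0, hπa]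
  refine ⟨⟨fun i hi => ?_, by rw [hTa], by rw [hTa]⟩, ?_⟩
  · rw [hTa]
    rcases eq_or_ne i 0 with rfl | hi0
    · rw [hT0, hc0]
      linarith
    · have hci := hahat_cost i (by omega) hi
      rw [hTi _ _ i hi0, hπ]
      split_ifs with h
      · rcases h with rfl | h <;> linarith
      · nlinarith
  · intro t₁ t₂ ht₁ ht₂ i hi hopt
    have opt_default := hopt 0 (Nat.zero_le n)
    have opt_a := hopt a han
    have opt_ahat := hopt ahat hahatn
    rw [hT0, hc0] at opt_default
    rw [hTa] at opt_a
    rcases eq_or_ne i 0 with rfl | hi0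
    · rw [hT0, hr0]
      linarith
    rcases eq_or_ne i a with rfl | hia
    · rw [hTa] at *
      rcases hca.eq_or_lt with heq | hlt
      · have := hahat_rew i ha1 han heq.symm
        linarith
      · have hne : ¬ (ahat = i ∨ c i < c ahat) := by
          rintro (h | h)
          · rw [h] at hlt
            exact lt_irrefl _ hlt
          · linarith
        have hqpos : 0 < (c i - c ahat) / s := div_pos (by linarith) hs_pos
        rw [hTi _ _ ahat hahat0, hπ ahat, if_neg hne] at opt_ahat
        have : s ≤ t₁ - t₂ := le_of_mul_le_mul_left (by linarith) hqpos
        linarith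
    · by_cases hlt : c a < c i
      · have : π i = 1 := by rw [hπ, if_pos (Or.inr hlt)]
        rw [hTi _ _ i hi0, this] at opt_a
        linarith
      · rcases (hahat_cost i (by omega) hi).eq_or_lt with heq | hgt
        · have := hahat_rew i (by omega) hi heq.symm
          linarith
        · have hne : ¬ (ahat = a ∨ c a < c ahat) := by
            rintro (h | h)
            · rw [h] at hgt
              exact hlt hgt
            · linarith
          have hπi : π i = π ahat := by
            rw [hπ i, hπ ahat, if_neg hne, if_neg (not_or.mpr ⟨hia, hlt⟩)]
          rw [hTi _ _ i hi0, hTi _ _ ahat hahat0, hπi] at opt_ahat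
          linarith
end

section
/- Let v : ℝ≥0 → ℝ≥0 be twice differentiable, strictly increasing, strictly concave, with v(0) = 0 and v(z)/z → 0 as z → ∞, and suppose c_â is in the range of v. Let a* ∈ {1,…,n} and (x*, y*) satisfy y* ≥ 0, y* + c_{a*} > 0, x* ≥ max{0, r_â − v⁻¹(c_â)}, x* < r_{a*}, and y* ≤ v(r_{a*} − x*) − c_{a*}. Let z* be the unique positive solution of v(z)/z = (y* + c_{a*})/(r_{a*} − x*), and set q* := (r_{a*} − x*)/z* and p* := q*·(y* + c_â)/(y* + c_{a*}). Define the binary-signal information structure by π_i = q* if i = a* or c_i > c_{a*}, and π_i = p* for all other i ∈ {1,…,n}. Then: (i) 0 ≤ p* ≤ q* ≤ 1, so the information structure is well defined; (ii) under the contract (t₁, t₂) = (z*, 0), the agent's utility at both a* and â equals y*, the action a* maximizes the agent's utility over all actions in {0,1,…,n}, and the principal's utility at a* equals x*; (iii) for every contract (t₁, t₂) with t₁, t₂ ≥ 0 and every action i ∈ {0,1,…,n} maximizing the agent's utility under that contract, the principal's utility r_i − T_i is at most x*; (iv) if moreover c_{a*} > c_â, then any contract (t₁, t₂) with t₁, t₂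 ≥ 0 under which a* maximizes the agent's utility and the principal's utility at a* equals x* satisfies (t₁, t₂) = (z*, 0). -/
/-- A strictly concave function with `v 0 = 0` has strictly decreasing average `v t / t`. -/
theorem StrictConcaveOn.div_lt_div_of_lt {v : ℝ → ℝ}
    (hv : StrictConcaveOn ℝ (Set.Ici 0) v) (hv0 : v 0 = 0) {s t : ℝ} (hs : 0 < s)
    (hst : s < t) : v t / t < v s / s := by
  have h := hv.slope_anti_adjacent (Set.mem_Ici.2 le_rfl)
    (Set.mem_Ici.2 (hs.trans hst).le) hs hst
  rw [hv0, sub_zero, sub_zero, div_lt_div_iff₀ (sub_pos.2 hst) hs] at h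
  rw [div_lt_div_iff₀ (hs.trans hst) hs]
  linarith

/-- If the expected utility of a binary lottery over nonnegative payments is at least `v w`, then
its expected payment is at least `w`. -/
theorem StrictMonoOn.le_of_concaveOn_of_le {v : ℝ → ℝ}
    (hmono : StrictMonoOn v (Set.Ici 0)) (hconc : ConcaveOn ℝ (Set.Ici 0) v)
    {w s t k : ℝ} (hw : 0 ≤ w) (hs : 0 ≤ s) (ht : 0 ≤ t) (hk0 : 0 ≤ k) (hk1 : k ≤ 1)
    (h : v w ≤ k * v s + (1 - k) * v t) : w ≤ k * s + (1 - k) * t := by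
  have hT : 0 ≤ k * s + (1 - k) * t :=
    add_nonneg (mul_nonneg hk0 hs) (mul_nonneg (sub_nonneg.2 hk1) ht)
  have hJ := hconc.2 (Set.mem_Ici.2 hs) (Set.mem_Ici.2 ht) hk0 (sub_nonneg.2 hk1)
    (add_sub_cancel k 1)
  simp only [smul_eq_mul] at hJ
  exact (hmono.le_iff_le (Set.mem_Ici.2 hw) (Set.mem_Ici.2 hT)).1 (h.trans hJ)

/-- Induced equilibrium with a risk-averse agent.  Actions are `0, 1, …, n`
with rewards `r` and costs `c` (`r 0 = c 0 = 0`); `ahat` is the cost-effective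
action.  The agent's von Neumann–Morgenstern utility `v : ℝ≥0 → ℝ≥0` is twice
differentiable, strictly increasing, strictly concave, with `v 0 = 0` and
`v z / z → 0`; `w = v⁻¹ (c ahat)`.  The target utility profile `(x, y)` of the
target action `a` satisfies `y ≥ 0`, `y + c a > 0`,
`x ≥ max 0 (r ahat - v⁻¹(c ahat))`, `x < r a`, and `y ≤ v (r a - x) - c a`.
`z` is the (unique) positive solution of `v z / z = (y + c a)/(r a - x)`,
`q = (r a - x)/z`, `p = q (y + c ahat)/(y + c a)`, and `π` is the
binary-signal information structure sending the first signal with probability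
`q` at `a` and at every costlier action, and with probability `p` otherwise.
`T t₁ t₂ i` and `A t₁ t₂ i` are the expected transfer and the agent's expected
utility at action `i` under the contract `(t₁, t₂)`.  Then:
(i) `0 ≤ p ≤ q ≤ 1`; (ii) under the contract `(z, 0)` the agent's utility at
both `a` and `ahat` equals `y`, the action `a` maximizes the agent's utility,
and the principal's utility at `a` equals `x`; (iii) for every nonnegative
contract and every agent-optimal action `i`, the principal's utility
`r i - T i` is at most `x`; (iv) if `c a > c ahat`, any nonnegative contract
under which `a` is agent-optimal and the principal's utility at `a` equals `x`
is the contract `(z, 0)`. -/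
theorem stmt_1
    (n : ℕ) (r c : ℕ → ℝ)
    (hr_nonneg : ∀ i ≤ n, 0 ≤ r i) (hc_nonneg : ∀ i ≤ n, 0 ≤ c i)
    (hr0 : r 0 = 0) (hc0 : c 0 = 0)
    (ahat : ℕ) (hahat1 : 1 ≤ ahat) (hahatn : ahat ≤ n)
    (hahat_cost : ∀ i, 1 ≤ i → i ≤ n → c ahat ≤ c i)
    (hahat_rew : ∀ i, 1 ≤ i → i ≤ n → c i = c ahat → r i ≤ r ahat)
    (v : ℝ → ℝ) (hv_diff : ContDiff ℝ 2 v)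
    (hv_mono : StrictMonoOn v (Set.Ici 0))
    (hv_conc : StrictConcaveOn ℝ (Set.Ici 0) v)
    (hv0 : v 0 = 0) (hv_nonneg : ∀ t, 0 ≤ t → 0 ≤ v t)
    (hv_lim : Filter.Tendsto (fun t => v t / t) Filter.atTop (nhds 0))
    (w : ℝ) (hw_nonneg : 0 ≤ w) (hw : v w = c ahat)
    (a : ℕ) (ha1 : 1 ≤ a) (han : a ≤ n)
    (x y : ℝ) (hy : 0 ≤ y) (hyc : 0 < y + c a)
    (hx_lb : max 0 (r ahat - w) ≤ x) (hx_ub : x < r a)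
    (hy_ub : y ≤ v (r a - x) - c a)
    (z : ℝ) (hz_pos : 0 < z) (hz : v z / z = (y + c a) / (r a - x))
    (q p : ℝ) (hq : q = (r a - x) / z) (hp : p = q * (y + c ahat) / (y + c a))
    (π : ℕ → ℝ) (hπ : ∀ i, π i = if i = a ∨ c a < c i then q else p)
    (T : ℝ → ℝ → ℕ → ℝ)
    (hT : ∀ t₁ t₂ i, T t₁ t₂ i = if i = 0 then 0 else π i * t₁ + (1 - π i) * t₂)
    (A : ℝ → ℝ → ℕ → ℝ)
    (hA : ∀ t₁ t₂ i,
      A t₁ t₂ i = if i = 0 then 0 else π i * v t₁ + (1 - π i) * v t₂ - c i) :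
    -- (i) the information structure is well defined
    (0 ≤ p ∧ p ≤ q ∧ q ≤ 1) ∧
    -- (ii) the contract (z, 0) induces the action a with utility profile (x, y)
    (A z 0 a = y ∧ A z 0 ahat = y ∧ (∀ i ≤ n, A z 0 i ≤ A z 0 a) ∧
      r a - T z 0 a = x) ∧
    -- (iii) no contract gives the principal more than x at an agent-optimal
    --       action
    (∀ t₁ t₂ : ℝ, 0 ≤ t₁ → 0 ≤ t₂ →
      ∀ i ≤ n, (∀ j ≤ n, A t₁ t₂ j ≤ A t₁ t₂ i) → r i - T t₁ t₂ i ≤ x) ∧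
    -- (iv) uniqueness of the optimal contract when c a > c ahat
    (c ahat < c a →
      ∀ t₁ t₂ : ℝ, 0 ≤ t₁ → 0 ≤ t₂ →
        (∀ j ≤ n, A t₁ t₂ j ≤ A t₁ t₂ a) → r a - T t₁ t₂ a = x →
        t₁ = z ∧ t₂ = 0) := by
  have hm : 0 < r a - x := sub_pos.2 hx_ub
  have hq0 : 0 < q := hq ▸ div_pos hm hz_pos
  have hqz : q * z = r a - x := by rw [hq]; field_simp
  have hqv : q * v z = y + c a := by
    rw [div_eq_div_iff hz_pos.ne' hm.ne'] at hz
    rw [hq]; field_simp; linarith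
  have hch : 0 ≤ c ahat := hc_nonneg _ hahatn
  have hcha : c ahat ≤ c a := hahat_cost a ha1 han
  have hpm : p * (y + c a) = q * (y + c ahat) := by rw [hp]; field_simp
  have hpv : p * v z = y + c ahat := by
    have : q * (p * v z) = q * (y + c ahat) := by rw [← hpm, ← hqv]; ring
    exact mul_left_cancel₀ hq0.ne' this
  have hp0 : 0 ≤ p := by
    rw [hp]; exact div_nonneg (mul_nonneg hq0.le (add_nonneg hy hch)) hyc.le
  have hpq : p ≤ q := by
    refine le_of_mul_le_mul_right ?_ hyc
    rw [hpm]; gcongr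
  have hq1 : q ≤ 1 := by
    rw [hq, div_le_one hz_pos]
    by_contra! h
    have h1 := hv_conc.div_lt_div_of_lt hv0 hz_pos h
    rw [hz, div_lt_div_iff_of_pos_right hm] at h1
    linarith
  have hx0 : 0 ≤ x := (le_max_left _ _).trans hx_lb
  have hxw : r ahat - w ≤ x := (le_max_right _ _).trans hx_lb
  have hpeq : c a = c ahat → p = q := by
    intro h
    rw [← h] at hpm
    exact mul_right_cancel₀ hyc.ne' hpm
  have hA0 : ∀ t₁ t₂, A t₁ t₂ 0 = 0 := fun t₁ t₂ => by simp [hA]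
  have hApos : ∀ t₁ t₂ i, 1 ≤ i → A t₁ t₂ i = π i * v t₁ + (1 - π i) * v t₂ - c i :=
    fun t₁ t₂ i hi => by rw [hA, if_neg (by omega)]
  have hTpos : ∀ t₁ t₂ i, 1 ≤ i → T t₁ t₂ i = π i * t₁ + (1 - π i) * t₂ :=
    fun t₁ t₂ i hi => by rw [hT, if_neg (by omega)]
  have hπa : π a = q := by simp [hπ]
  have hπh : π ahat = p := by
    rw [hπ]
    split_ifs with h
    · rcases h with h | h
      · exact (hpeq (by rw [h])).symm
      · linarith
    · rfl
  have hAa : A z 0 a = y := by rw [hApos _ _ _ ha1, hπa, hv0]; linarith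
  -- a contract implementing a costlier target action pays at least `z` after the first signal
  have key : c ahat < c a → ∀ t₁ t₂ : ℝ, (∀ j ≤ n, A t₁ t₂ j ≤ A t₁ t₂ a) →
      v z + v t₂ ≤ v t₁ := by
    intro hlt t₁ t₂ hopt
    have h := hopt ahat hahatn
    rw [hApos _ _ _ ha1, hApos _ _ _ hahat1, hπa, hπh] at h
    have hd : (q - p) * v z = c a - c ahat := by rw [sub_mul, hqv, hpv]; ring
    have hvz : 0 ≤ v z := hv_nonneg z hz_pos.le
    have hqp : 0 < q - p := pos_of_mul_pos_left (hd ▸ sub_pos.2 hlt) hvz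
    have : (q - p) * (v z + v t₂) ≤ (q - p) * v t₁ := by rw [mul_add, hd]; linarith
    exact le_of_mul_le_mul_left this hqp
  have keyz : c ahat < c a → ∀ t₁ t₂ : ℝ, 0 ≤ t₁ → 0 ≤ t₂ →
      (∀ j ≤ n, A t₁ t₂ j ≤ A t₁ t₂ a) → z ≤ t₁ := by
    intro hlt t₁ t₂ h1 h2 hopt
    have := key hlt t₁ t₂ hopt
    have := hv_nonneg t₂ h2
    exact (hv_mono.le_iff_le (Set.mem_Ici.2 hz_pos.le) (Set.mem_Ici.2 h1)).1 (by linarith)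
  refine ⟨⟨hp0, hpq, hq1⟩, ⟨hAa, ?_, ?_, ?_⟩, ?_, ?_⟩
  · rw [hApos _ _ _ hahat1, hπh, hv0]; linarith
  · intro i hi
    rw [hAa]
    rcases Nat.eq_zero_or_pos i with rfl | hi1
    · rw [hA0]; exact hy
    · rw [hApos _ _ _ hi1, hv0, hπ]
      split_ifs with h
      · rcases h with rfl | h <;> linarith
      · linarith [hahat_cost i hi1 hi]
  · rw [hTpos _ _ _ ha1, hπa]; linarith
  · intro t₁ t₂ h1 h2 i hi hopt
    rcases Nat.eq_zero_or_pos i with rfl | hi1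
    · simpa [hT, hr0] using hx0
    have hir : 0 ≤ π i * v t₁ + (1 - π i) * v t₂ - c i := by
      simpa only [hA0, hApos _ _ _ hi1] using hopt 0 n.zero_le
    have hπ01 : 0 ≤ π i ∧ π i ≤ 1 := by
      rw [hπ]
      split_ifs
      · exact ⟨hq0.le, hq1⟩
      · exact ⟨hp0, hpq.trans hq1⟩
    -- an agent-optimal action of minimal cost
    have hmin : c i = c ahat → r i - T t₁ t₂ i ≤ x := by
      intro hci
      have hrw := hahat_rew i hi1 hi hci
      have := hv_mono.le_of_concaveOn_of_le hv_conc.concaveOn hw_nonneg h1 h2 hπ01.1 hπ01.2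
        (by rw [hw]; linarith)
      rw [hTpos _ _ _ hi1]
      linarith
    rcases eq_or_ne i a with rfl | hia
    · rcases hcha.eq_or_lt with h | h
      · exact hmin h.symm
      · have hz1 := mul_le_mul_of_nonneg_left (keyz h t₁ t₂ h1 h2 hopt) hq0.le
        have hz2 := mul_nonneg (sub_nonneg.2 hq1) h2
        rw [hTpos _ _ _ ha1, hπa]
        linarith
    · by_cases hlt : c a < c i
      · have h := hopt a han
        rw [hApos _ _ _ ha1, hApos _ _ _ hi1, hπa, hπ i, if_pos (Or.inr hlt)] at h
        linarith
      · have h := hopt ahat hahatn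
        rw [hApos _ _ _ hahat1, hApos _ _ _ hi1, hπh, hπ i, if_neg (by tauto)] at h
        exact hmin (le_antisymm (by linarith) (hahat_cost i hi1 hi))
  · intro hlt t₁ t₂ h1 h2 hopt hx
    have hz1 := keyz hlt t₁ t₂ h1 h2 hopt
    have hk := key hlt t₁ t₂ hopt
    rw [hTpos _ _ _ ha1, hπa] at hx
    have hz2 := mul_nonneg (sub_nonneg.2 hq1) h2
    have ht1 : t₁ = z := le_antisymm (le_of_mul_le_mul_left (by linarith) hq0) hz1
    refine ⟨ht1, le_antisymm ?_ h2⟩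
    refine (hv_mono.le_iff_le (Set.mem_Ici.2 h2) (Set.mem_Ici.2 le_rfl)).1 ?_
    rw [ht1] at hk
    linarith
end

section
/- Let y ≥ 0, c_A > c_B ≥ 0, 0 < q ≤ 1, and set p := q·(y + c_B)/(y + c_A). Then 0 ≤ p < q, and for all real numbers V₁ and V₂ with V₂ ≥ 0 and V₁ ≥ V₂ + (c_A − c_B)/(q − p), one has q·V₁ + (1 − q)·V₂ − c_A ≥ V₂ + y ≥ 0. In particular, any contract under which the agent weakly prefers the target action to the cheapest alternative automatically gives the agent nonnegative utility at the target action. -/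
/-- In the risk-averse-agent information structure, the target action emits the
first signal with probability `q` and the cheapest alternative with probability
`p := q (y + cB)/(y + cA)`.  Then `0 ≤ p < q`, and for values `V₁ = v(t₁)`,
`V₂ = v(t₂)` of the transfers, if the agent weakly prefers the target action to
the alternative (i.e. `V₁ ≥ V₂ + (cA - cB)/(q - p)`), then her utility at the
target action is at least `V₂ + y ≥ 0`. -/
theorem stmt_3 (y cA cB q : ℝ) (hy : 0 ≤ y) (hB : 0 ≤ cB) (hBA : cB < cA)
    (hq0 : 0 < q) (hq1 : q ≤ 1)
    (p : ℝ) (hp : p = q * (y + cB) / (y + cA)) :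
    (0 ≤ p ∧ p < q) ∧
    ∀ V₁ V₂ : ℝ, 0 ≤ V₂ → V₂ + (cA - cB) / (q - p) ≤ V₁ →
      V₂ + y ≤ q * V₁ + (1 - q) * V₂ - cA ∧ 0 ≤ V₂ + y := by
  have hyA : 0 < y + cA := by linarith
  have hd : cA - cB ≠ 0 := by linarith
  have hgap : q - p = q * (cA - cB) / (y + cA) := by
    rw [hp]
    field_simp
    ring
  have hquot : (cA - cB) / (q - p) = (y + cA) / q := by
    rw [hgap]
    field_simp
  have hgap_pos : 0 < q - p := by
    rw [hgap]
    exact div_pos (mul_pos hq0 (sub_pos.mpr hBA)) hyA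
  refine ⟨⟨by rw [hp]; positivity, sub_pos.mp hgap_pos⟩, fun V₁ V₂ hV₂ hV => ⟨?_, by positivity⟩⟩
  rw [hquot, ← le_sub_iff_add_le', div_le_iff₀ hq0] at hV
  linarith
end

section
/- Let v : ℝ≥0 → ℝ≥0 be continuous, strictly increasing, and strictly concave with v(0) = 0 and v(z)/z → 0 as z → ∞. Let w > 0 and let K be a real number with 0 < K ≤ v(w)/w. Then there exists exactly one z > 0 with v(z)/z = K, and this unique solution satisfies z ≥ w. -/
/-- The ratio `v z / z` of a strictly concave function vanishing at `0` is strictly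
decreasing on the positive half-line. -/
theorem StrictConcaveOn.strictAntiOn_div_self {v : ℝ → ℝ}
    (hconc : StrictConcaveOn ℝ (Set.Ici 0) v) (h0 : v 0 = 0) :
    StrictAntiOn (fun z => v z / z) (Set.Ioi 0) := by
  intro x hx y hy hxy
  have hx' : (0 : ℝ) < x := hx
  have hy' : (0 : ℝ) < y := hy
  have h := hconc.secant_strict_mono (a := 0) (x := x) (y := y) (Set.mem_Ici.2 le_rfl)
    (Set.mem_Ici.2 hx'.le) (Set.mem_Ici.2 hy'.le) hx'.ne' hy'.ne' hxy
  simpa [h0] using h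


/-- Existence and uniqueness of the transfer `z*` in the risk-averse-agent
construction: if `v : ℝ≥0 → ℝ≥0` is continuous, strictly increasing and strictly
concave with `v 0 = 0` and `v z / z → 0` at infinity, and `0 < K ≤ v w / w` for
some `w > 0`, then the equation `v z / z = K` has exactly one positive solution,
and this solution satisfies `z ≥ w`. -/
theorem stmt_5 (v : ℝ → ℝ) (hcont : ContinuousOn v (Set.Ici 0))
    (hmono : StrictMonoOn v (Set.Ici 0))
    (hconc : StrictConcaveOn ℝ (Set.Ici 0) v)
    (h0 : v 0 = 0) (hnn : ∀ t, 0 ≤ t → 0 ≤ v t)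
    (hlim : Filter.Tendsto (fun t => v t / t) Filter.atTop (nhds 0))
    (w K : ℝ) (hw : 0 < w) (hK0 : 0 < K) (hKw : K ≤ v w / w) :
    (∃! z : ℝ, 0 < z ∧ v z / z = K) ∧
    ∀ z : ℝ, 0 < z → v z / z = K → w ≤ z := by
  have hanti := hconc.strictAntiOn_div_self h0
  have hge : ∀ z : ℝ, 0 < z → v z / z = K → w ≤ z := by
    intro z hz hzK
    by_contra! hzw
    have h : v w / w < v z / z := hanti hz hw hzw
    linarith
  refine ⟨?_, hge⟩
  obtain ⟨b, hbK, hwb⟩ :=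
    ((hlim.eventually_lt_const hK0).and (Filter.eventually_ge_atTop w)).exists
  have hdiv : ContinuousOn (fun t => v t / t) (Set.Icc w b) :=
    (hcont.mono fun t ht => hw.le.trans ht.1).div continuousOn_id
      fun t ht => (hw.trans_le ht.1).ne'
  obtain ⟨z, hz, hzK⟩ := intermediate_value_Icc' hwb hdiv ⟨hbK.le, hKw⟩
  have hz0 : 0 < z := hw.trans_le hz.1
  exact ⟨z, ⟨hz0, hzK⟩, fun y hy => hanti.injOn hy.1 hz0 (hy.2.trans hzK.symm)⟩
end

section
/- Let v : ℝ≥0 → ℝ≥0 be twice differentiable, strictly increasing (v′ > 0), and concave (v″ ≤ 0), with v(0) = 0 and v(z)/z → 0 as z → ∞. Let r ≥ 0 and c ≥ 0 satisfy v(r) ≥ c. Then there exists z ≥ 0 such that the equation x·v(r − x) = c·x + z has exactly one solution x in the interval [0, r]. -/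
/-- If `v' > 0` and `v'' ≤ 0` on `[0, ∞)`, the product `x * (v (r - x) - c)` is strictly
concave in `x` on `[0, r]`. -/
theorem strictConcaveOn_mul_comp_sub {v v' v'' : ℝ → ℝ}
    (hd1 : ∀ t, HasDerivAt v (v' t) t) (hd2 : ∀ t, HasDerivAt v' (v'' t) t)
    (hv'pos : ∀ t, 0 ≤ t → 0 < v' t) (hv''nonpos : ∀ t, 0 ≤ t → v'' t ≤ 0) (r c : ℝ) :
    StrictConcaveOn ℝ (Set.Icc 0 r) (fun x => x * v (r - x) - c * x) := by
  have hsub (x : ℝ) : HasDerivAt (fun y => r - y) (-1) x := (hasDerivAt_id' x).const_sub r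
  have hf (x : ℝ) : HasDerivAt (fun x => x * v (r - x) - c * x)
      (v (r - x) - x * v' (r - x) - c) x := by
    refine (((hasDerivAt_id' x).mul ((hd1 (r - x)).comp x (hsub x))).sub
      ((hasDerivAt_id' x).const_mul c)).congr_deriv ?_
    simp only [Function.comp_apply]
    ring
  have hf' (x : ℝ) : HasDerivAt (fun x => v (r - x) - x * v' (r - x) - c)
      (-2 * v' (r - x) + x * v'' (r - x)) x := by
    refine ((((hd1 (r - x)).comp x (hsub x)).sub
      ((hasDerivAt_id' x).mul ((hd2 (r - x)).comp x (hsub x)))).sub_const c).congr_deriv ?_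
    simp only [Function.comp_apply]
    ring
  refine strictConcaveOn_of_deriv2_neg (convex_Icc 0 r)
    (fun x _ => (hf x).continuousAt.continuousWithinAt) fun x hx => ?_
  rw [interior_Icc] at hx
  have hrx : 0 ≤ r - x := by linarith [hx.2]
  rw [Function.iterate_succ_apply, Function.iterate_one, funext fun y => (hf y).deriv,
    (hf' x).deriv]
  nlinarith [hv'pos _ hrx, mul_nonneg hx.1.le (neg_nonneg.2 (hv''nonpos _ hrx))]

/-- Tangency lemma for the maximal Nash product with a risk-averse agent:
for `v : ℝ≥0 → ℝ≥0` twice differentiable with `v' > 0` and `v'' ≤ 0` on `[0, ∞)`,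
`v 0 = 0`, `v z / z → 0` at infinity, and `r, c ≥ 0` with `v r ≥ c`, there exists
`z ≥ 0` such that the equation `x * v (r - x) = c * x + z` has exactly one
solution `x` in `[0, r]`. -/
theorem stmt_6 (v v' v'' : ℝ → ℝ)
    (hd1 : ∀ t, HasDerivAt v (v' t) t) (hd2 : ∀ t, HasDerivAt v' (v'' t) t)
    (hv'pos : ∀ t, 0 ≤ t → 0 < v' t) (hv''nonpos : ∀ t, 0 ≤ t → v'' t ≤ 0)
    (hv0 : v 0 = 0) (hvnn : ∀ t, 0 ≤ t → 0 ≤ v t)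
    (hlim : Filter.Tendsto (fun t => v t / t) Filter.atTop (nhds 0))
    (r c : ℝ) (hr : 0 ≤ r) (hc : 0 ≤ c) (hvr : c ≤ v r) :
    ∃ z : ℝ, 0 ≤ z ∧ ∃! x : ℝ, x ∈ Set.Icc 0 r ∧ x * v (r - x) = c * x + z := by
  have hconc := strictConcaveOn_mul_comp_sub hd1 hd2 hv'pos hv''nonpos r c
  have hv : Continuous v := continuous_iff_continuousAt.2 fun t => (hd1 t).continuousAt
  have h0 : (0 : ℝ) ∈ Set.Icc 0 r := ⟨le_rfl, hr⟩
  obtain ⟨x, hx, hmax⟩ := isCompact_Icc.exists_isMaxOn ⟨0, h0⟩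
    (f := fun x => x * v (r - x) - c * x) (by fun_prop)
  refine ⟨x * v (r - x) - c * x, by simpa using hmax h0, x, ⟨hx, by ring⟩, ?_⟩
  rintro y ⟨hy, hyx⟩
  refine hconc.eq_of_isMaxOn (isMaxOn_iff.2 fun w hw => (hmax hw).trans ?_) hmax hy hx
  simp only
  linarith
end

section
/- Let v : ℝ≥0 → ℝ≥0 be twice differentiable with v′ > 0 and v″ ≤ 0 on [0, ∞), v(0) = 0, and let r > 0 and c ≥ 0 satisfy v(r) ≥ c. Then there exists a unique x_c ∈ [0, r] such that v(r − x_c) − x_c·v′(r − x_c) = c, and the number z := x_c·v(r − x_c) − c·x_c is nonnegative. -/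
/-- First-order condition for maximizing the Nash product with a risk-averse
agent: for `v : ℝ≥0 → ℝ≥0` twice differentiable with `v' > 0` and `v'' ≤ 0` on
`[0, ∞)`, `v 0 = 0`, `r > 0` and `0 ≤ c ≤ v r`, the equation
`v (r - x) - x * v' (r - x) = c` has a unique solution `x_c ∈ [0, r]`, and the
corresponding value `z = x_c * v (r - x_c) - c * x_c` is nonnegative. -/
theorem stmt_8 (v v' v'' : ℝ → ℝ)
    (hd1 : ∀ t, HasDerivAt v (v' t) t) (hd2 : ∀ t, HasDerivAt v' (v'' t) t)
    (hv'pos : ∀ t, 0 ≤ t → 0 < v' t) (hv''nonpos : ∀ t, 0 ≤ t → v'' t ≤ 0)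
    (hv0 : v 0 = 0) (hvnn : ∀ t, 0 ≤ t → 0 ≤ v t)
    (r c : ℝ) (hr : 0 < r) (hc : 0 ≤ c) (hvr : c ≤ v r) :
    (∃! x : ℝ, x ∈ Set.Icc 0 r ∧ v (r - x) - x * v' (r - x) = c) ∧
    (∀ x ∈ Set.Icc 0 r, v (r - x) - x * v' (r - x) = c →
      0 ≤ x * v (r - x) - c * x) := by
  have hderiv (x : ℝ) : HasDerivAt (fun x => v (r - x) - x * v' (r - x))
      (-2 * v' (r - x) + x * v'' (r - x)) x := by
    have hsub : HasDerivAt (fun x => r - x) (-1) x := by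
      simpa using (hasDerivAt_id x).const_sub r
    have h1 := (hd1 (r - x)).comp x hsub
    have h2 := (hd2 (r - x)).comp x hsub
    exact (h1.sub ((hasDerivAt_id x).mul h2)).congr_deriv (by
      simp only [id_eq, Function.comp_apply]; ring)
  have hcont : ContinuousOn (fun x => v (r - x) - x * v' (r - x)) (Set.Icc 0 r) :=
    fun x _ => (hderiv x).continuousAt.continuousWithinAt
  have hanti : StrictAntiOn (fun x => v (r - x) - x * v' (r - x)) (Set.Icc 0 r) := by
    refine strictAntiOn_of_deriv_neg (convex_Icc 0 r) hcont fun x hx => ?_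
    rw [interior_Icc] at hx
    have hrx : 0 ≤ r - x := sub_nonneg.2 hx.2.le
    rw [(hderiv x).deriv]
    have := mul_nonpos_of_nonneg_of_nonpos hx.1.le (hv''nonpos _ hrx)
    linarith [hv'pos _ hrx]
  refine ⟨?_, fun x hx hxc => ?_⟩
  · have hmem : c ∈ Set.Icc (v (r - r) - r * v' (r - r)) (v (r - 0) - 0 * v' (r - 0)) := by
      have := mul_pos hr (hv'pos 0 le_rfl)
      simp only [sub_self, hv0, sub_zero, zero_mul]
      exact ⟨by linarith, hvr⟩
    obtain ⟨x, hx, hxc⟩ := intermediate_value_Icc' hr.le hcont hmem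
    exact ⟨x, ⟨hx, hxc⟩, fun y ⟨hy, hyc⟩ => hanti.injOn hy hx (hyc.trans hxc.symm)⟩
  · have := mul_nonneg hx.1 (mul_nonneg hx.1 (hv'pos _ (sub_nonneg.2 hx.2)).le)
    rw [← hxc]
    linarith
end

section
/- Let v : ℝ≥0 → ℝ≥0 be twice differentiable with v′ > 0 and v″ ≤ 0 on [0, ∞), v(0) = 0, let r > 0 and c ≥ 0 with v(r) ≥ c, and let x_c ∈ [0, r] be the unique solution of v(r − x) − x·v′(r − x) = c. Let [L, U] ⊆ [0, r] with L ≤ U. Then for the function g(x) = x·(v(r − x) − c): (i) if L ≤ x_c ≤ U, then x_c maximizes g over [L, U]; (ii) if x_c < L, then L maximizes g over [L, U]. -/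
open Set

/-- The marginal Nash product `v (r - x) - x * v' (r - x)` is antitone on `[0, r]` when
`v` is increasing and concave on `[0, ∞)`. -/
theorem antitoneOn_marginalNashProduct {v v' v'' : ℝ → ℝ}
    (hd1 : ∀ t, HasDerivAt v (v' t) t) (hd2 : ∀ t, HasDerivAt v' (v'' t) t)
    (hv' : ∀ t, 0 ≤ t → 0 ≤ v' t) (hv'' : ∀ t, 0 ≤ t → v'' t ≤ 0) (r : ℝ) :
    AntitoneOn (fun x => v (r - x) - x * v' (r - x)) (Icc 0 r) := by
  have hv_mono : MonotoneOn v (Ici 0) :=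
    monotoneOn_of_hasDerivWithinAt_nonneg (convex_Ici 0)
      (fun t _ => (hd1 t).continuousAt.continuousWithinAt)
      (fun t _ => (hd1 t).hasDerivWithinAt) (fun t ht => hv' t (interior_subset ht))
  have hv'_anti : AntitoneOn v' (Ici 0) :=
    antitoneOn_of_hasDerivWithinAt_nonpos (convex_Ici 0)
      (fun t _ => (hd2 t).continuousAt.continuousWithinAt)
      (fun t _ => (hd2 t).hasDerivWithinAt) (fun t ht => hv'' t (interior_subset ht))
  intro x hx y hy hxy
  have hxr : (0 : ℝ) ≤ r - x := sub_nonneg.2 hx.2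
  have hyr : (0 : ℝ) ≤ r - y := sub_nonneg.2 hy.2
  have hle : r - y ≤ r - x := sub_le_sub_left hxy r
  exact sub_le_sub (hv_mono hyr hxr hle)
    (mul_le_mul hxy (hv'_anti hyr hxr hle) (hv' _ hxr) hy.1)

theorem hasDerivAt_nashProduct {v v' : ℝ → ℝ} (hd : ∀ t, HasDerivAt v (v' t) t) (r c x : ℝ) :
    HasDerivAt (fun x => x * (v (r - x) - c)) (v (r - x) - x * v' (r - x) - c) x := by
  have h := (hasDerivAt_id x).mul (((hd (r - x)).comp_const_sub r x).sub_const c)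
  exact h.congr_deriv (by simp only [id]; ring)

/-- Correctness of the Nash-product-optimal utility profile of a given action
with a risk-averse agent: with `g x = x * (v (r - x) - c)` on the implementable
range `[L, U] ⊆ [0, r]` and `x_c ∈ [0, r]` the solution of the first-order
condition `v (r - x) - x * v' (r - x) = c`, (i) if `L ≤ x_c ≤ U` then `x_c`
maximizes `g` over `[L, U]`; (ii) if `x_c < L` then `L` maximizes `g` over
`[L, U]`. -/
theorem stmt_15 (v v' v'' : ℝ → ℝ)
    (hd1 : ∀ t, HasDerivAt v (v' t) t) (hd2 : ∀ t, HasDerivAt v' (v'' t) t)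
    (hv'pos : ∀ t, 0 ≤ t → 0 < v' t) (hv''nonpos : ∀ t, 0 ≤ t → v'' t ≤ 0)
    (hv0 : v 0 = 0) (hvnn : ∀ t, 0 ≤ t → 0 ≤ v t)
    (r c : ℝ) (hr : 0 < r) (hc : 0 ≤ c) (hvr : c ≤ v r)
    (xc : ℝ) (hxc : xc ∈ Set.Icc 0 r)
    (hxceq : v (r - xc) - xc * v' (r - xc) = c)
    (L U : ℝ) (hL0 : 0 ≤ L) (hLU : L ≤ U) (hUr : U ≤ r) :
    (L ≤ xc → xc ≤ U →
      ∀ x ∈ Set.Icc L U, x * (v (r - x) - c) ≤ xc * (v (r - xc) - c)) ∧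
    (xc < L →
      ∀ x ∈ Set.Icc L U, x * (v (r - x) - c) ≤ L * (v (r - L) - c)) := by
  have hanti := antitoneOn_marginalNashProduct hd1 hd2 (fun t ht => (hv'pos t ht).le) hv''nonpos r
  have hder := hasDerivAt_nashProduct hd1 r c
  have hinc : MonotoneOn (fun x => x * (v (r - x) - c)) (Set.Icc 0 xc) :=
    monotoneOn_of_hasDerivWithinAt_nonneg (convex_Icc 0 xc)
      (fun x _ => (hder x).continuousAt.continuousWithinAt)
      (fun x _ => (hder x).hasDerivWithinAt) fun x hx => by
        have hx := interior_subset hx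
        exact sub_nonneg.2 (hxceq.ge.trans (hanti ⟨hx.1, hx.2.trans hxc.2⟩ hxc hx.2))
  have hdec : AntitoneOn (fun x => x * (v (r - x) - c)) (Set.Icc xc r) :=
    antitoneOn_of_hasDerivWithinAt_nonpos (convex_Icc xc r)
      (fun x _ => (hder x).continuousAt.continuousWithinAt)
      (fun x _ => (hder x).hasDerivWithinAt) fun x hx => by
        have hx := interior_subset hx
        exact sub_nonpos.2 ((hanti hxc ⟨hxc.1.trans hx.1, hx.2⟩ hx.1).trans hxceq.le)
  refine ⟨fun _ _ x hx => ?_, fun hL x hx => ?_⟩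
  · rcases le_total x xc with h | h
    · exact hinc ⟨hL0.trans hx.1, h⟩ ⟨hxc.1, le_rfl⟩ h
    · exact hdec ⟨le_rfl, hxc.2⟩ ⟨h, hx.2.trans hUr⟩ h
  · exact hdec ⟨hL.le, hLU.trans hUr⟩ ⟨hL.le.trans hx.1, hx.2.trans hUr⟩ hx.1
end
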